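/- For every old position k with m+1 ≤ k ≤ N, setting i = #{ℓ ∈ [1,m] : S[ℓ..N] ≺ S[k..N]}, and for every character c of Σ, one has Rank(c,i) = #{ℓ ∈ [2,m] : S[ℓ−1] = c and S[ℓ..N] ≺ S[k..N]}. Moreover, if m+2 ≤ k ≤ N and c = S[k−1], this quantity also equals #{ℓ ∈ [1,m−1] : S[ℓ] = c and S[ℓ..N] ≺ S[k−1..N]}. -/

import Mathlib

open Finset

/-- A subset of `[1, m]` that is closed under passing to smaller positive numbers is an initial
segment. -/
theorem eq_Icc_one_card_of_downward_closed {D : Finset ℕ} (hpos : ∀ j ∈ D, 1 ≤ j)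
    (hdown : ∀ j ∈ D, ∀ j', 1 ≤ j' → j' < j → j' ∈ D) : D = Icc 1 D.card := by
  refine eq_of_subset_of_card_le (fun j hj => mem_Icc.2 ⟨hpos j hj, ?_⟩) (by simp)
  have hsub : Icc 1 j ⊆ D := fun j' hj' => by
    obtain ⟨h1, h2⟩ := mem_Icc.1 hj'
    rcases h2.lt_or_eq with h | rfl
    · exact hdown j hj j' h1 h
    · exact hj
  simpa using card_le_card hsub

theorem drop_eq_getElem!_cons {α : Type*} [Inhabited α] {S : List α} {p : ℕ}
    (hp : p < S.length) : S.drop p = S[p]! :: S.drop (p + 1) := by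
  rw [getElem!_pos S p hp, List.drop_eq_getElem_cons hp]

theorem lex_drop_iff_of_getElem!_eq {α : Type*} [LinearOrder α] [Inhabited α] {S : List α}
    {p q : ℕ} (hp : p < S.length) (hq : q < S.length) (h : S[p]! = S[q]!) :
    List.Lex (· < ·) (S.drop p) (S.drop q) ↔
      List.Lex (· < ·) (S.drop (p + 1)) (S.drop (q + 1)) := by
  rw [drop_eq_getElem!_cons hp, drop_eq_getElem!_cons hq, h]
  exact List.lex_cons_iff

/-- Setting as in the paper: `S` is a string of length `N` over a linearly ordered alphabet
whose last character occurs nowhere else; `1 ≤ m < N`; suffixes starting in `[1,m]` are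
*new*; `sa_int` enumerates the new suffixes in increasing lexicographic order; `bwt_int`
is the corresponding BWT-like array (`none` plays the role of the symbol `#`);
`Rank c i` counts the occurrences of `c` in `bwt_int[1..i]`.

Claim: for every old position `k ∈ [m+1,N]`, with
`i = #{ℓ ∈ [1,m] : S[ℓ..N] ≺ S[k..N]}`, and every character `c`,
`Rank(c,i) = #{ℓ ∈ [2,m] : S[ℓ-1] = c ∧ S[ℓ..N] ≺ S[k..N]}`; moreover, if
`m+2 ≤ k` and `c = S[k-1]`, this also equals
`#{ℓ ∈ [1,m-1] : S[ℓ] = c ∧ S[ℓ..N] ≺ S[k-1..N]}`.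
(1-based positions `p` correspond to 0-based indices `p-1`.) -/
theorem stmt1 {α : Type*} [LinearOrder α] [Inhabited α]
    (S : List α) (N m : ℕ) (hN : S.length = N)
    (hlast : ∀ k, 1 ≤ k → k < N → S[k-1]! ≠ S[N-1]!)
    (hm1 : 1 ≤ m) (hmN : m < N)
    (sa_int : ℕ → ℕ)
    (hsa_mem : ∀ j ∈ Icc 1 m, sa_int j ∈ Icc 1 m)
    (hsa_inj : ∀ j₁ ∈ Icc 1 m, ∀ j₂ ∈ Icc 1 m, sa_int j₁ = sa_int j₂ → j₁ = j₂)
    (hsa_surj : ∀ ℓ ∈ Icc 1 m, ∃ j ∈ Icc 1 m, sa_int j = ℓ)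
    (hsa_sorted : ∀ j₁ j₂, 1 ≤ j₁ → j₁ < j₂ → j₂ ≤ m →
      List.Lex (· < ·) (S.drop (sa_int j₁ - 1)) (S.drop (sa_int j₂ - 1)))
    (bwt_int : ℕ → Option α)
    (hbwt : ∀ j ∈ Icc 1 m,
      bwt_int j = if 1 < sa_int j then some (S[sa_int j - 2]!) else none)
    (Rank : α → ℕ → ℕ)
    (hRank : ∀ c i, Rank c i = ((Icc 1 i).filter (fun j => bwt_int j = some c)).card)
    (k : ℕ) (hk1 : m + 1 ≤ k) (hk2 : k ≤ N)
    (i : ℕ)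
    (hi : i = ((Icc 1 m).filter
      (fun ℓ => List.Lex (· < ·) (S.drop (ℓ-1)) (S.drop (k-1)))).card)
    (c : α) :
    Rank c i = ((Icc 2 m).filter
        (fun ℓ => S[ℓ-2]! = c ∧
          List.Lex (· < ·) (S.drop (ℓ-1)) (S.drop (k-1)))).card ∧
    (m + 2 ≤ k → c = S[k-2]! →
      Rank c i = ((Icc 1 (m-1)).filter
        (fun ℓ => S[ℓ-1]! = c ∧
          List.Lex (· < ·) (S.drop (ℓ-1)) (S.drop (k-2)))).card) := by
  classical
  have hD : (Icc 1 m).filter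
      (fun j => List.Lex (· < ·) (S.drop (sa_int j - 1)) (S.drop (k-1))) = Icc 1 i := by
    have hcard : ((Icc 1 m).filter
        (fun j => List.Lex (· < ·) (S.drop (sa_int j - 1)) (S.drop (k-1)))).card = i := by
      rw [hi]
      refine card_bij (fun j _ => sa_int j) ?_ ?_ ?_
      · intro j hj
        rw [mem_filter] at hj ⊢
        exact ⟨hsa_mem j hj.1, hj.2⟩
      · intro j₁ h₁ j₂ h₂ h
        exact hsa_inj j₁ (mem_filter.1 h₁).1 j₂ (mem_filter.1 h₂).1 h
      · intro ℓ hℓ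
        rw [mem_filter] at hℓ
        obtain ⟨j, hj, rfl⟩ := hsa_surj ℓ hℓ.1
        exact ⟨j, mem_filter.2 ⟨hj, hℓ.2⟩, rfl⟩
    rw [← hcard]
    apply eq_Icc_one_card_of_downward_closed
    · intro j hj
      exact (mem_Icc.1 (mem_filter.1 hj).1).1
    · intro j hj j' h1 hlt
      obtain ⟨hjm, hjk⟩ := mem_filter.1 hj
      have hjm := (mem_Icc.1 hjm).2
      have hlex := hsa_sorted j' j h1 hlt hjm
      refine mem_filter.2 ⟨mem_Icc.2 ⟨h1, by omega⟩, ?_⟩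
      exact List.lt_trans (show S.drop (sa_int j' - 1) < S.drop (sa_int j - 1) from hlex) hjk
  have hfirst : Rank c i = ((Icc 2 m).filter
      (fun ℓ => S[ℓ-2]! = c ∧
        List.Lex (· < ·) (S.drop (ℓ-1)) (S.drop (k-1)))).card := by
    rw [hRank, ← hD]
    have hmem : ∀ j ∈ Icc 1 m, bwt_int j = some c ↔ 2 ≤ sa_int j ∧ S[sa_int j - 2]! = c := by
      intro j hj
      rw [hbwt j hj]
      split_ifs with h
      · simp only [Option.some.injEq]
        exact ⟨fun e => ⟨h, e⟩, fun e => e.2⟩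
      · simp only [false_iff]
        exact fun e => h e.1
    refine card_bij (fun j _ => sa_int j) ?_ ?_ ?_
    · intro j hj
      obtain ⟨hj, hb⟩ := mem_filter.1 hj
      obtain ⟨hj, hlex⟩ := mem_filter.1 hj
      obtain ⟨h2, hc⟩ := (hmem j hj).1 hb
      exact mem_filter.2 ⟨mem_Icc.2 ⟨h2, (mem_Icc.1 (hsa_mem j hj)).2⟩, hc, hlex⟩
    · intro j₁ h₁ j₂ h₂ h
      exact hsa_inj j₁ (mem_filter.1 (mem_filter.1 h₁).1).1 j₂
        (mem_filter.1 (mem_filter.1 h₂).1).1 h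
    · intro ℓ hℓ
      obtain ⟨hℓ, hc, hlex⟩ := mem_filter.1 hℓ
      obtain ⟨h2, hm⟩ := mem_Icc.1 hℓ
      obtain ⟨j, hj, rfl⟩ := hsa_surj ℓ (mem_Icc.2 ⟨by omega, hm⟩)
      exact ⟨j, mem_filter.2 ⟨mem_filter.2 ⟨hj, hlex⟩, (hmem j hj).2 ⟨h2, hc⟩⟩, rfl⟩
  refine ⟨hfirst, fun hk hck => hfirst.trans ?_⟩
  have hshift : ∀ ℓ, 2 ≤ ℓ → ℓ ≤ m → S[ℓ-2]! = c →
      (List.Lex (· < ·) (S.drop (ℓ-2)) (S.drop (k-2)) ↔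
        List.Lex (· < ·) (S.drop (ℓ-1)) (S.drop (k-1))) := by
    intro ℓ h2 hm hc
    have h := lex_drop_iff_of_getElem!_eq (S := S) (p := ℓ - 2) (q := k - 2)
      (by omega) (by omega) (hc.trans hck)
    rwa [show ℓ - 2 + 1 = ℓ - 1 by omega, show k - 2 + 1 = k - 1 by omega] at h
  refine card_bij (fun ℓ _ => ℓ - 1) ?_ ?_ ?_
  · intro ℓ hℓ
    obtain ⟨hℓ, hc, hlex⟩ := mem_filter.1 hℓ
    obtain ⟨h2, hm⟩ := mem_Icc.1 hℓ
    refine mem_filter.2 ⟨mem_Icc.2 ⟨by omega, by omega⟩, ?_⟩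
    rw [show ℓ - 1 - 1 = ℓ - 2 by omega]
    exact ⟨hc, (hshift ℓ h2 hm hc).2 hlex⟩
  · intro ℓ₁ h₁ ℓ₂ h₂ h
    have := mem_Icc.1 (mem_filter.1 h₁).1
    have := mem_Icc.1 (mem_filter.1 h₂).1
    omega
  · intro ℓ hℓ
    obtain ⟨hℓ, hc, hlex⟩ := mem_filter.1 hℓ
    obtain ⟨h1, hm⟩ := mem_Icc.1 hℓ
    rw [show ℓ - 1 = ℓ + 1 - 2 by omega] at hc hlex
    exact ⟨ℓ + 1, mem_filter.2 ⟨mem_Icc.2 ⟨by omega, by omega⟩, hc,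
      (hshift (ℓ + 1) (by omega) (by omega) hc).1 hlex⟩, by simp⟩
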